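/- Let ε₀ > 0. Assume that W ⊆ ℝ^p is nonempty and compact, that for every x ∈ 𝒳 the map w ∈ W ↦ ψ_w(x) ∈ ℝ^d is Lipschitz continuous with a constant L_W independent of x, and that f⁰ is bounded and measurable. Then there exists w* ∈ W attaining the minimum of the regularized risk w ↦ R_{ε₀}(w) := E_{X,Z}[Σ_{y∈Y} p_0(y | ψ_w(X) + ε₀·Z) · f⁰(y, X)] over W. -/

import Mathlib

open MeasureTheory Metric Real
open scoped RealInnerProductSpace

noncomputable section

/-- Density of the Gaussian measure `N(0, σ²·I_d)` on `ℝ^d`. -/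
def gaussDensity (d : ℕ) (σ : ℝ) (v : EuclideanSpace ℝ (Fin d)) : ℝ :=
  (2 * π * σ ^ 2) ^ (-(d : ℝ) / 2) * Real.exp (-‖v‖ ^ 2 / (2 * σ ^ 2))

/-- The Gaussian measure `N(0, σ²·I_d)` on `ℝ^d`. -/
def gaussMeasure (d : ℕ) (σ : ℝ) : Measure (EuclideanSpace ℝ (Fin d)) :=
  volume.withDensity fun v => ENNReal.ofReal (gaussDensity d σ v)

/-- Normal cone `F_y` of the finite set `Y` at the point `y`. -/
def normalCone {d : ℕ} (Y : Finset (EuclideanSpace ℝ (Fin d)))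
    (y : EuclideanSpace ℝ (Fin d)) : Set (EuclideanSpace ℝ (Fin d)) :=
  {θ | ∀ y' ∈ Y, ⟪y', θ⟫ ≤ ⟪y, θ⟫}

/-- Internal cone radius `ρ(θ)`. -/
def coneRadius {d : ℕ} (Y : Finset (EuclideanSpace ℝ (Fin d)))
    (θ : EuclideanSpace ℝ (Fin d)) : ℝ :=
  sSup {r : ℝ | 0 < r ∧ ∀ u ∈ closedBall (0 : EuclideanSpace ℝ (Fin d)) 1,
    ∃ y ∈ Y, θ ∈ normalCone Y y ∧ θ + r • u ∈ normalCone Y y}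

/-- Uniform probability measure on the closed Euclidean unit ball of `ℝ^d`. -/
def uniformBall (d : ℕ) : Measure (EuclideanSpace ℝ (Fin d)) :=
  (volume (closedBall (0 : EuclideanSpace ℝ (Fin d)) 1))⁻¹ •
    volume.restrict (closedBall (0 : EuclideanSpace ℝ (Fin d)) 1)

/-- `p_0(y|θ) = P[θ + ρ(θ)·U ∈ F_y]` for `U` uniform on the closed unit ball. -/
def p0 {d : ℕ} (Y : Finset (EuclideanSpace ℝ (Fin d)))
    (y θ : EuclideanSpace ℝ (Fin d)) : ℝ :=
  (uniformBall d {u | θ + coneRadius Y θ • u ∈ normalCone Y y}).toReal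

lemma isClosed_normalCone {d : ℕ} (Y : Finset (EuclideanSpace ℝ (Fin d)))
    (y : EuclideanSpace ℝ (Fin d)) : IsClosed (normalCone Y y) := by
  simp only [normalCone, Set.ofPred_forall]
  refine isClosed_iInter fun y' => isClosed_iInter fun _ => ?_
  exact isClosed_le (by fun_prop) (by fun_prop)

/-- The centres `θ` for which `r` is admissible in the definition of the cone radius. -/
def admissibleCenters {d : ℕ} (Y : Finset (EuclideanSpace ℝ (Fin d))) (r : ℝ) :
    Set (EuclideanSpace ℝ (Fin d)) :=
  {θ | ∀ u ∈ closedBall (0 : EuclideanSpace ℝ (Fin d)) 1,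
    ∃ y ∈ Y, θ ∈ normalCone Y y ∧ θ + r • u ∈ normalCone Y y}

lemma isClosed_admissibleCenters {d : ℕ} (Y : Finset (EuclideanSpace ℝ (Fin d))) (r : ℝ) :
    IsClosed (admissibleCenters Y r) := by
  classical
  have key : admissibleCenters Y r = ⋃ T ∈ Y.powerset,
      ((⋂ y ∈ T, normalCone Y y) ∩
        ⋂ u ∈ closedBall (0 : EuclideanSpace ℝ (Fin d)) 1,
          (fun θ => θ + r • u) ⁻¹' ⋃ y ∈ T, normalCone Y y) := by
    ext θ
    simp only [admissibleCenters, Set.mem_ofPred_eq, Set.mem_iUnion, Set.mem_inter_iff,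
      Set.mem_iInter, Set.mem_preimage, Finset.mem_powerset, exists_prop]
    constructor
    · intro h
      refine ⟨Y.filter fun y => θ ∈ normalCone Y y, Finset.filter_subset _ _, ?_, ?_⟩
      · exact fun y hy => (Finset.mem_filter.1 hy).2
      · intro u hu
        obtain ⟨y, hy, h1, h2⟩ := h u hu
        exact ⟨y, Finset.mem_filter.2 ⟨hy, h1⟩, h2⟩
    · rintro ⟨T, hT, h1, h2⟩ u hu
      obtain ⟨y, hy, h⟩ := h2 u hu
      exact ⟨y, hT hy, h1 y hy, h⟩
  rw [key]
  refine isClosed_biUnion_finset fun T _ => IsClosed.inter ?_ ?_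
  · exact isClosed_biInter fun y _ => isClosed_normalCone Y y
  · refine isClosed_biInter fun u _ => IsClosed.preimage (by fun_prop) ?_
    exact isClosed_biUnion_finset fun y _ => isClosed_normalCone Y y

lemma admissibleCenters_anti {d : ℕ} (Y : Finset (EuclideanSpace ℝ (Fin d))) {r s : ℝ}
    (hr : 0 < r) (hrs : r ≤ s) : admissibleCenters Y s ⊆ admissibleCenters Y r := by
  intro θ hθ u hu
  have hs : 0 < s := hr.trans_le hrs
  have hmem : (r / s) • u ∈ closedBall (0 : EuclideanSpace ℝ (Fin d)) 1 := by
    rw [mem_closedBall_zero_iff] at hu ⊢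
    rw [norm_smul, Real.norm_of_nonneg (by positivity)]
    exact mul_le_one₀ ((div_le_one hs).2 hrs) (norm_nonneg _) hu
  obtain ⟨y, hy, h1, h2⟩ := hθ _ hmem
  refine ⟨y, hy, h1, ?_⟩
  rwa [smul_smul, mul_div_cancel₀ _ hs.ne'] at h2

lemma coneRadius_nonneg {d : ℕ} (Y : Finset (EuclideanSpace ℝ (Fin d)))
    (θ : EuclideanSpace ℝ (Fin d)) : 0 ≤ coneRadius Y θ :=
  Real.sSup_nonneg fun _ hr => hr.1.le

lemma measurable_coneRadius {d : ℕ} (Y : Finset (EuclideanSpace ℝ (Fin d))) :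
    Measurable (coneRadius Y) := by
  refine measurable_of_Ioi fun a => ?_
  rcases lt_or_ge a 0 with ha | ha
  · convert MeasurableSet.univ
    exact Set.eq_univ_of_forall fun θ => ha.trans_le (coneRadius_nonneg Y θ)
  have key : coneRadius Y ⁻¹' Set.Ioi a =
      (⋃ q : ℚ, ⋃ _ : a < q, admissibleCenters Y q) ∩
        ⋃ n : ℕ, (admissibleCenters Y ((n : ℝ) + 1))ᶜ := by
    ext θ
    have hdef : coneRadius Y θ = sSup {r : ℝ | 0 < r ∧ θ ∈ admissibleCenters Y r} := rfl
    simp only [Set.mem_preimage, Set.mem_Ioi, Set.mem_inter_iff, Set.mem_iUnion, exists_prop,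
      Set.mem_compl_iff, hdef]
    constructor
    · intro h
      have hne : {r : ℝ | 0 < r ∧ θ ∈ admissibleCenters Y r}.Nonempty := by
        by_contra hne
        rw [Set.not_nonempty_iff_eq_empty.1 hne, Real.sSup_empty] at h
        exact absurd h ha.not_gt
      have hbdd : BddAbove {r : ℝ | 0 < r ∧ θ ∈ admissibleCenters Y r} := by
        by_contra hb
        rw [Real.sSup_of_not_bddAbove hb] at h
        exact absurd h ha.not_gt
      constructor
      · obtain ⟨r, hr, har⟩ := exists_lt_of_lt_csSup hne h
        obtain ⟨q, haq, hqr⟩ := exists_rat_btwn har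
        exact ⟨q, haq, admissibleCenters_anti Y (ha.trans_lt haq) hqr.le hr.2⟩
      · obtain ⟨M, hM⟩ := hbdd
        obtain ⟨n, hn⟩ := exists_nat_gt M
        refine ⟨n, fun hmem => ?_⟩
        have := hM ⟨by positivity, hmem⟩
        linarith
    · rintro ⟨⟨q, haq, hq⟩, n, hn⟩
      refine haq.trans_le (le_csSup ⟨(n : ℝ) + 1, ?_⟩ ⟨ha.trans_lt haq, hq⟩)
      rintro r ⟨-, hr⟩
      by_contra! hlt
      exact hn (admissibleCenters_anti Y (by positivity) hlt.le hr)
  rw [key]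
  refine MeasurableSet.inter ?_ ?_
  · exact MeasurableSet.iUnion fun q => MeasurableSet.iUnion fun _ =>
      (isClosed_admissibleCenters Y q).measurableSet
  · exact MeasurableSet.iUnion fun n => (isClosed_admissibleCenters Y _).measurableSet.compl

instance isFiniteMeasure_uniformBall (d : ℕ) : IsFiniteMeasure (uniformBall d) :=
  ⟨by
    rw [uniformBall, Measure.smul_apply, Measure.restrict_apply_univ, smul_eq_mul]
    exact (ENNReal.inv_mul_le_one _).trans_lt ENNReal.one_lt_top⟩

lemma uniformBall_le_one (d : ℕ) (s : Set (EuclideanSpace ℝ (Fin d))) :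
    uniformBall d s ≤ 1 := by
  refine (measure_mono (Set.subset_univ s)).trans ?_
  rw [uniformBall, Measure.smul_apply, Measure.restrict_apply_univ, smul_eq_mul]
  exact ENNReal.inv_mul_le_one _

lemma abs_p0_le_one {d : ℕ} (Y : Finset (EuclideanSpace ℝ (Fin d)))
    (y θ : EuclideanSpace ℝ (Fin d)) : |p0 Y y θ| ≤ 1 := by
  rw [p0, abs_of_nonneg ENNReal.toReal_nonneg]
  exact ENNReal.toReal_le_of_le_ofReal zero_le_one (by simpa using uniformBall_le_one d _)

lemma measurable_p0 {d : ℕ} (Y : Finset (EuclideanSpace ℝ (Fin d)))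
    (y : EuclideanSpace ℝ (Fin d)) : Measurable (p0 Y y) := by
  have hmap : Measurable fun q : EuclideanSpace ℝ (Fin d) × EuclideanSpace ℝ (Fin d) =>
      q.1 + coneRadius Y q.1 • q.2 :=
    measurable_fst.add (((measurable_coneRadius Y).comp measurable_fst).smul measurable_snd)
  exact (measurable_measure_prodMk_left
    (hmap (isClosed_normalCone Y y).measurableSet)).ennreal_toReal

lemma integrable_exp_neg_mul_sq_norm {d : ℕ} {b : ℝ} (hb : 0 < b) :
    Integrable fun v : EuclideanSpace ℝ (Fin d) => Real.exp (-b * ‖v‖ ^ 2) := by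
  have h := GaussianFourier.integrable_cexp_neg_mul_sq_norm_add
    (V := EuclideanSpace ℝ (Fin d)) (b := (b : ℂ)) (by simpa using hb) 0 0
  refine h.norm.congr (Filter.Eventually.of_forall fun v => ?_)
  simp [Complex.norm_exp, ← Complex.ofReal_pow]

lemma gaussDensity_nonneg (d : ℕ) (σ : ℝ) (v : EuclideanSpace ℝ (Fin d)) :
    0 ≤ gaussDensity d σ v := by
  unfold gaussDensity
  positivity

lemma continuous_gaussDensity (d : ℕ) (σ : ℝ) : Continuous (gaussDensity d σ) := by
  unfold gaussDensity
  fun_prop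

lemma integrable_gaussDensity (d : ℕ) {σ : ℝ} (hσ : σ ≠ 0) :
    Integrable (gaussDensity d σ) := by
  have hb : 0 < (2 * σ ^ 2)⁻¹ := by positivity
  refine ((integrable_exp_neg_mul_sq_norm (d := d) hb).const_mul
    ((2 * π * σ ^ 2) ^ (-(d : ℝ) / 2))).congr (Filter.Eventually.of_forall fun v => ?_)
  simp only [gaussDensity]
  congr 2
  ring

lemma isFiniteMeasure_gaussMeasure (d : ℕ) {σ : ℝ} (hσ : σ ≠ 0) :
    IsFiniteMeasure (gaussMeasure d σ) :=
  isFiniteMeasure_withDensity_ofReal (integrable_gaussDensity d hσ).2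

lemma integral_gaussMeasure (d : ℕ) (σ : ℝ) (g : EuclideanSpace ℝ (Fin d) → ℝ) :
    ∫ z, g z ∂(gaussMeasure d σ) = ∫ z, gaussDensity d σ z * g z := by
  rw [gaussMeasure, integral_withDensity_eq_integral_toReal_smul
    (continuous_gaussDensity d σ).measurable.ennreal_ofReal (by simp)]
  simp [ENNReal.toReal_ofReal (gaussDensity_nonneg d σ _)]

/-- Near `a₀`, translates by `a` of a Gaussian density are dominated by a multiple of the
translate by `a₀` of a wider Gaussian. -/
lemma gaussDensity_sub_le (d : ℕ) (σ : ℝ) {a a₀ : EuclideanSpace ℝ (Fin d)}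
    (ha : ‖a - a₀‖ ≤ 1) (v : EuclideanSpace ℝ (Fin d)) :
    gaussDensity d σ (v - a) ≤ (2 * π * σ ^ 2) ^ (-(d : ℝ) / 2) *
      (Real.exp ((2 * σ ^ 2)⁻¹) * Real.exp (-((2 * σ ^ 2)⁻¹ / 2) * ‖v - a₀‖ ^ 2)) := by
  unfold gaussDensity
  rw [← Real.exp_add]
  refine mul_le_mul_of_nonneg_left (Real.exp_le_exp.2 ?_) (by positivity)
  have htri : ‖v - a₀‖ ≤ ‖v - a‖ + ‖a - a₀‖ := norm_sub_le_norm_sub_add_norm_sub v a a₀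
  have hsq : ‖v - a₀‖ ^ 2 ≤ 2 * ‖v - a‖ ^ 2 + 2 := by
    nlinarith [norm_nonneg (v - a₀), norm_nonneg (v - a), sq_nonneg (‖v - a‖ - 1)]
  have hb : 0 ≤ (2 * σ ^ 2)⁻¹ := by positivity
  rw [div_eq_mul_inv]
  nlinarith

/-- Gaussian smoothing turns bounded measurable functions into continuous ones. -/
lemma continuous_integral_gaussMeasure {d : ℕ} {σ : ℝ} (hσ : σ ≠ 0) {ε : ℝ} (hε : ε ≠ 0)
    {g : EuclideanSpace ℝ (Fin d) → ℝ} (hg : Measurable g) {M : ℝ} (hM : ∀ v, |g v| ≤ M) :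
    Continuous fun a => ∫ z, g (a + ε • z) ∂(gaussMeasure d σ) := by
  have hM0 : 0 ≤ M := (abs_nonneg _).trans (hM 0)
  have hshift : (fun a => ∫ z, g (a + ε • z) ∂(gaussMeasure d σ)) =
      fun a => ∫ v, gaussDensity d σ (v - ε⁻¹ • a) * g (ε • v) := by
    funext a
    rw [integral_gaussMeasure, ← integral_sub_right_eq_self _ (ε⁻¹ • a)]
    refine integral_congr_ae (Filter.Eventually.of_forall fun v => ?_)
    simp [smul_sub, smul_smul, hε]
  have hcont : Continuous fun a => ∫ v, gaussDensity d σ (v - a) * g (ε • v) := by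
    refine continuous_iff_continuousAt.2 fun a₀ => ?_
    have hb : 0 < (2 * σ ^ 2)⁻¹ / 2 := by positivity
    refine continuousAt_of_dominated (bound := fun v =>
      ((2 * π * σ ^ 2) ^ (-(d : ℝ) / 2) *
        (Real.exp ((2 * σ ^ 2)⁻¹) * Real.exp (-((2 * σ ^ 2)⁻¹ / 2) * ‖v - a₀‖ ^ 2))) * M)
      ?_ ?_ ?_ ?_
    · refine Filter.Eventually.of_forall fun a => Measurable.aestronglyMeasurable ?_
      exact ((continuous_gaussDensity d σ).measurable.comp (measurable_id.sub_const a)).mul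
        (hg.comp (measurable_const_smul ε))
    · filter_upwards [closedBall_mem_nhds a₀ one_pos] with a ha
      refine Filter.Eventually.of_forall fun v => ?_
      rw [norm_mul, Real.norm_of_nonneg (gaussDensity_nonneg d σ _), Real.norm_eq_abs]
      exact mul_le_mul (gaussDensity_sub_le d σ (mem_closedBall_iff_norm.1 ha) v) (hM _)
        (abs_nonneg _) (by positivity)
    · exact ((((integrable_exp_neg_mul_sq_norm (d := d) hb).comp_sub_right a₀).const_mul
        _).const_mul _).mul_const _
    · refine Filter.Eventually.of_forall fun v => ContinuousAt.mul_const ?_ _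
      exact ((continuous_gaussDensity d σ).comp (by fun_prop)).continuousAt
  rw [hshift]
  exact hcont.comp (continuous_const_smul ε⁻¹)

/-- For `ε₀ > 0`, if `W` is nonempty compact, the statistical model is uniformly Lipschitz
in the parameter, and `f⁰` is bounded measurable, then the regularized risk
`w ↦ R_{ε₀}(w) = E_{X,Z}[Σ_{y∈Y} p_0(y|ψ_w(X)+ε₀Z)·f⁰(y,X)]` (with `Z ~ N(0,(1/d)·I_d)`
independent of `X`) attains its minimum over `W` at some `w* ∈ W`. -/
theorem statement6 {d p : ℕ} (hd : 1 ≤ d) (Y : Finset (EuclideanSpace ℝ (Fin d)))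
    (hY : Y.Nonempty)
    {𝒳 : Type*} [MeasurableSpace 𝒳] (μ : Measure 𝒳) [IsProbabilityMeasure μ]
    (W : Set (EuclideanSpace ℝ (Fin p))) (hWne : W.Nonempty) (hWcpt : IsCompact W)
    (ψ : EuclideanSpace ℝ (Fin p) → 𝒳 → EuclideanSpace ℝ (Fin d))
    (hψmeas : ∀ w, Measurable (ψ w))
    (LW : ℝ) (hψlip : ∀ x : 𝒳, ∀ w ∈ W, ∀ w' ∈ W, ‖ψ w x - ψ w' x‖ ≤ LW * ‖w - w'‖)
    (f : EuclideanSpace ℝ (Fin d) → 𝒳 → ℝ) (hfmeas : ∀ y, Measurable (f y))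
    (Cf : ℝ) (hfbd : ∀ y x, |f y x| ≤ Cf)
    (ε₀ : ℝ) (hε : 0 < ε₀)
    (R : EuclideanSpace ℝ (Fin p) → ℝ)
    (hR : ∀ w, R w = ∫ x, ∫ z, (∑ y ∈ Y, p0 Y y (ψ w x + ε₀ • z) * f y x)
        ∂(gaussMeasure d (Real.sqrt d)⁻¹) ∂μ) :
    ∃ wstar ∈ W, ∀ w ∈ W, R wstar ≤ R w := by
  have hσ : (Real.sqrt d)⁻¹ ≠ 0 :=
    inv_ne_zero (Real.sqrt_ne_zero'.2 (by exact_mod_cast hd))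
  have := isFiniteMeasure_gaussMeasure d hσ
  have hbound : ∀ x θ, |∑ y ∈ Y, p0 Y y θ * f y x| ≤ Y.card * Cf := by
    intro x θ
    refine (Finset.abs_sum_le_sum_abs _ _).trans ?_
    rw [← nsmul_eq_mul]
    refine Finset.sum_le_card_nsmul _ _ _ fun y _ => ?_
    rw [abs_mul]
    exact (mul_le_of_le_one_left (abs_nonneg _) (abs_p0_le_one Y y θ)).trans (hfbd y x)
  have hcont : ContinuousOn R W := by
    rw [funext hR]
    refine continuousOn_of_dominated
      (bound := fun _ => Y.card * Cf * (gaussMeasure d (Real.sqrt d)⁻¹).real Set.univ)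
      ?_ ?_ (integrable_const _) ?_
    · intro w _
      refine StronglyMeasurable.aestronglyMeasurable ?_
      refine StronglyMeasurable.integral_prod_right
        (f := fun x z => ∑ y ∈ Y, p0 Y y (ψ w x + ε₀ • z) * f y x) ?_
      refine Measurable.stronglyMeasurable ?_
      refine Finset.measurable_fun_sum _ fun y _ => ?_
      refine Measurable.mul ((measurable_p0 Y y).comp ?_) ((hfmeas y).comp measurable_fst)
      exact ((hψmeas w).comp measurable_fst).add (measurable_snd.const_smul ε₀)
    · intro w _
      refine Filter.Eventually.of_forall fun x => ?_
      exact norm_integral_le_of_norm_le_const (Filter.Eventually.of_forall fun z => hbound x _)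
    · refine Filter.Eventually.of_forall fun x => ?_
      have hψ : ContinuousOn (fun w => ψ w x) W := by
        refine (LipschitzOnWith.of_dist_le_mul (K := LW.toNNReal) fun w hw w' hw' => ?_).continuousOn
        rw [dist_eq_norm, dist_eq_norm]
        exact (hψlip x w hw w' hw').trans
          (mul_le_mul_of_nonneg_right (Real.le_coe_toNNReal LW) (norm_nonneg _))
      exact (continuous_integral_gaussMeasure hσ hε.ne'
        (g := fun θ => ∑ y ∈ Y, p0 Y y θ * f y x)
        (Finset.measurable_fun_sum _ fun y _ => (measurable_p0 Y y).mul_const _)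
        (hbound x)).comp_continuousOn hψ
  exact hWcpt.exists_isMinOn hWne hcont
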